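/- For every positive even integer k and every rational α ∉ ℤ, the number \(\psi_k(1-\alpha) - \psi_k(\alpha)\) is transcendental unless α is a half-integer, in which case it is zero. -/

import Mathlib

noncomputable def digamma (x : ℝ) : ℝ := deriv Real.Gamma x / Real.Gamma x

open Polynomial in
theorem aux_integral_aeval {L : Type*} [Field L] (f g : ℤ[X]) (b : L) (hb : aeval b f = 0)
    (D : ℕ) (hD : g.natDegree ≤ D) :
    IsIntegral ℤ ((f.leadingCoeff : L) ^ D * aeval b g) := by
  have h1 : IsIntegral ℤ ((f.leadingCoeff : L) * b) := by
    have := isIntegral_leadingCoeff_smul f b hb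
    simpa [zsmul_eq_mul] using this
  have h2 : IsIntegral ℤ ((f.leadingCoeff : L)) := by
    simpa using (isIntegral_algebraMap (R := ℤ) (A := L) (x := f.leadingCoeff))
  rw [aeval_eq_sum_range, Finset.mul_sum]
  refine IsIntegral.sum _ fun i hi => ?_
  have hi' : i ≤ D := by
    have := Finset.mem_range.1 hi
    omega
  have : (f.leadingCoeff : L) ^ D * g.coeff i • b ^ i
      = (f.leadingCoeff : L) ^ (D - i) * ((g.coeff i : L) * ((f.leadingCoeff : L) * b) ^ i) := by
    rw [zsmul_eq_mul, mul_pow]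
    nth_rewrite 1 [← Nat.sub_add_cancel hi']
    rw [pow_add]; ring
  rw [this]
  refine (h2.pow _).mul (IsIntegral.mul ?_ (h1.pow _))
  simpa using (isIntegral_algebraMap (R := ℤ) (A := L) (x := g.coeff i))

open scoped Nat in
theorem aux_limit (A B C : ℝ) : Filter.Tendsto (fun p : ℕ => A * (B ^ p * (C ^ p / (p - 1)!)))
    Filter.atTop (nhds 0) := by
  rw [← Filter.tendsto_add_atTop_iff_nat 1]
  have := (FloorSemiring.tendsto_pow_div_factorial_atTop (B * C)).const_mul (A * (B * C))
  rw [mul_zero] at this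
  refine this.congr fun n => ?_
  simp only [Nat.add_sub_cancel]
  rw [mul_pow, pow_succ, pow_succ]; ring

open Polynomial in
open scoped Classical in
theorem aux_exp_ne {L : Type*} [Field L] [Algebra ℚ L] [FiniteDimensional ℚ L] [IsGalois ℚ L]
    (φ : L →+* ℂ) (γ : L) : Complex.exp (φ γ) + 1 ≠ 0 := by
  intro h0
  let β : Finset Gal(L/ℚ) → L := fun S => ∑ σ ∈ S, σ γ
  have hsum : ∑ S : Finset Gal(L/ℚ), Complex.exp (φ (β S)) = 0 := by
    have h1 : ∏ σ : Gal(L/ℚ), (Complex.exp (φ (σ γ)) + 1) = 0 :=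
      Finset.prod_eq_zero (Finset.mem_univ 1) (by simpa using h0)
    rw [Finset.prod_add_one, Finset.powerset_univ] at h1
    rw [← h1]
    refine Finset.sum_congr rfl fun S _ => ?_
    simp only [β, map_sum, Complex.exp_sum]
  let T : Finset (Finset Gal(L/ℚ)) := Finset.univ.filter fun S => β S ≠ 0
  let N : ℕ := (Finset.univ.filter fun S => ¬ β S ≠ 0).card
  have hN : 0 < N := by
    refine Finset.card_pos.2 ⟨∅, ?_⟩
    simp [β]
  have hsum2 : ∑ S ∈ T, Complex.exp (φ (β S)) + N = 0 := by
    rw [← hsum, ← Finset.sum_filter_add_sum_filter_not Finset.univ (fun S => β S ≠ 0)]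
    congr 1
    rw [Finset.sum_congr rfl (g := fun _ => (1 : ℂ))]
    · simp [N]
    · intro S hS
      have : β S = 0 := by simpa using hS
      simp [this]
  -- polynomial
  have hq : ∀ S : Finset Gal(L/ℚ), ∃ q : ℤ[X], q.coeff 0 ≠ 0 ∧ (β S ≠ 0 → aeval (β S) q = 0) := by
    intro S
    by_cases hS : β S = 0
    · exact ⟨1, by simp, fun h => absurd hS h⟩
    · have halg : IsAlgebraic ℤ (β S) :=
        (IsFractionRing.isAlgebraic_iff ℤ ℚ L).2 (Algebra.IsAlgebraic.isAlgebraic _)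
      obtain ⟨q, h1, h2⟩ := halg.exists_nonzero_coeff_and_aeval_eq_zero
        (mem_nonZeroDivisors_of_ne_zero hS)
      exact ⟨q, h1, fun _ => h2⟩
  choose q hq0 hqr using hq
  let f : ℤ[X] := ∏ S : Finset Gal(L/ℚ), q S
  have hf0 : f.eval 0 ≠ 0 := by
    simp only [f, eval_prod]
    refine Finset.prod_ne_zero_iff.2 fun S _ => ?_
    rw [← coeff_zero_eq_eval_zero]; exact hq0 S
  have hfne : f ≠ 0 := by rintro h; simp [h] at hf0
  have hfr : ∀ S ∈ T, aeval (β S) f = 0 := by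
    intro S hS
    simp only [f, map_prod]
    exact Finset.prod_eq_zero (Finset.mem_univ S) (hqr S (by simpa [T] using hS))
  have hfr' : ∀ S ∈ T, φ (β S) ∈ f.aroots ℂ := by
    intro S hS
    rw [mem_aroots]
    refine ⟨hfne, ?_⟩
    have := congrArg φ (hfr S hS)
    rw [map_zero, aeval_def, hom_eval₂] at this
    rw [aeval_def, ← this]
    congr 1
    exact Subsingleton.elim _ _
  obtain ⟨c, hc⟩ := LindemannWeierstrass.exp_polynomial_approx f hf0
  set a : ℤ := f.leadingCoeff with ha
  have hane : a ≠ 0 := leadingCoeff_ne_zero.2 hfne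
  -- choose p
  have hlim := aux_limit T.card (|(a : ℝ)| ^ f.natDegree) c
  have hev := (hlim.eventually_lt_const (zero_lt_one)).and
    ((Filter.eventually_gt_atTop (eval 0 f).natAbs).and
      ((Filter.eventually_gt_atTop a.natAbs).and (Filter.eventually_gt_atTop N)))
  obtain ⟨p0, hp0⟩ := Filter.eventually_atTop.1 hev
  obtain ⟨p, hpge, hp⟩ := Nat.exists_infinite_primes p0
  obtain ⟨hsmall, hpf, hpa, hpN⟩ := hp0 p hpge
  obtain ⟨n, hn, g, hg, happ⟩ := hc p hpf hp
  let D := p * f.natDegree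
  -- integer
  have hint : ∃ M : ℤ, (a : L) ^ D * ∑ S ∈ T, aeval (β S) g = M := by
    have hI : IsIntegral ℤ ((a : L) ^ D * ∑ S ∈ T, aeval (β S) g) := by
      rw [Finset.mul_sum]
      refine IsIntegral.sum _ fun S hS => ?_
      exact aux_integral_aeval f g (β S) (hfr S hS) D (hg.trans (Nat.sub_le _ _))
    have hfix : ∀ τ : Gal(L/ℚ), τ ((a : L) ^ D * ∑ S ∈ T, aeval (β S) g)
        = (a : L) ^ D * ∑ S ∈ T, aeval (β S) g := by
      intro τ
      have hβ : ∀ S : Finset Gal(L/ℚ), β (S.map (Equiv.mulLeft τ).toEmbedding) = τ (β S) := by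
        intro S
        simp [β, map_sum]
      rw [map_mul, map_pow, map_intCast, map_sum]
      congr 1
      refine Finset.sum_bij (fun S _ => S.map (Equiv.mulLeft τ).toEmbedding) ?_ ?_ ?_ ?_
      · intro S hS
        simp only [T, Finset.mem_filter, Finset.mem_univ, true_and] at hS ⊢
        rw [hβ]; simpa using hS
      · intro S _ S' _ h
        exact Finset.map_injective _ h
      · intro S hS
        have hSS : (S.map (Equiv.mulLeft τ⁻¹).toEmbedding).map (Equiv.mulLeft τ).toEmbedding = S := by
          ext x; simp
        refine ⟨S.map (Equiv.mulLeft τ⁻¹).toEmbedding, ?_, hSS⟩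
        simp only [T, Finset.mem_filter, Finset.mem_univ, true_and] at hS ⊢
        intro h
        apply hS
        rw [← hSS, hβ, h, map_zero]
      · intro S _
        rw [hβ]
        have := (aeval_algHom_apply (τ.toAlgHom.restrictScalars ℤ) (β S) g)
        simpa using this.symm
    have hmem := (IsGalois.mem_bot_iff_fixed _).2 hfix
    obtain ⟨r, hr⟩ := IntermediateField.mem_bot.1 hmem
    rw [← hr] at hI
    have hI' : IsIntegral ℤ r := (isIntegral_algebraMap_iff (algebraMap ℚ L).injective).1 hI
    obtain ⟨M, hM⟩ := IsIntegrallyClosed.isIntegral_iff.1 hI'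
    refine ⟨M, ?_⟩
    rw [← hr, ← hM]; simp
  obtain ⟨M, hM⟩ := hint
  have hMC : (a : ℂ) ^ D * ∑ S ∈ T, aeval (φ (β S)) g = M := by
    have := congrArg φ hM
    rw [map_mul, map_pow, map_intCast, map_sum, map_intCast] at this
    rw [← this]
    congr 1
    refine Finset.sum_congr rfl fun S _ => ?_
    exact aeval_algHom_apply (RingHom.toIntAlgHom φ) (β S) g
  -- the key integer
  have hkey : ((a ^ D * n * N + p * M : ℤ) : ℂ)
      = - ((a : ℂ) ^ D * ∑ S ∈ T, (n • Complex.exp (φ (β S)) - p • aeval (φ (β S)) g)) := by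
    rw [Finset.sum_sub_distrib, mul_sub, ← Finset.smul_sum, ← Finset.smul_sum]
    push_cast
    rw [← hMC, zsmul_eq_mul, nsmul_eq_mul]
    linear_combination ((a : ℂ) ^ D * n) * hsum2
  have hbound : ‖((a ^ D * n * N + p * M : ℤ) : ℂ)‖ < 1 := by
    refine lt_of_le_of_lt ?_ hsmall
    rw [hkey, norm_neg, norm_mul, norm_pow, Complex.norm_intCast]
    calc |(a : ℝ)| ^ D * ‖∑ S ∈ T, (n • Complex.exp (φ (β S)) - p • aeval (φ (β S)) g)‖
        ≤ |(a : ℝ)| ^ D * (T.card * (c ^ p / (p - 1).factorial)) := by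
          gcongr
          refine (norm_sum_le_of_le T fun S hS => happ (hfr' S hS)).trans ?_
          simp
      _ = _ := by
          simp only [D]
          rw [mul_comm p, pow_mul]; ring
  have hzero : a ^ D * n * N + p * M = 0 := by
    rw [Complex.norm_intCast] at hbound
    have : |a ^ D * n * N + p * M| < 1 := by exact_mod_cast hbound
    exact Int.abs_lt_one_iff.1 this
  have hdvd : (p : ℤ) ∣ a ^ D * n * N := by
    rw [eq_neg_of_add_eq_zero_left hzero]
    exact (dvd_mul_right _ _).neg_right
  have hpp : Prime (p : ℤ) := Nat.prime_iff_prime_int.1 hp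
  rcases hpp.dvd_or_dvd hdvd with h | h
  · rcases hpp.dvd_or_dvd h with h | h
    · have := hpp.dvd_of_dvd_pow h
      have := Int.natCast_dvd.1 this
      have := Nat.le_of_dvd (Int.natAbs_pos.2 hane) this
      omega
    · exact hn h
  · have := Int.natCast_dvd_natCast.1 h
    have := Nat.le_of_dvd hN this
    omega

theorem exists_galois_aux {F : Type} [Field F] [Algebra F ℂ] (z : ℂ) (hz : IsIntegral F z)
    (hsep : (minpoly F z).Separable) :
    ∃ (L : Type) (_ : Field L) (_ : Algebra F L) (_ : FiniteDimensional F L) (_ : IsGalois F L)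
      (φ : L →+* ℂ) (γ : L), φ γ = z := by
  let P := minpoly F z
  have hsp : (P.map (algebraMap F P.SplittingField)).Splits := Polynomial.SplittingField.splits P
  have hG : IsGalois F P.SplittingField := IsGalois.of_separable_splitting_field (p := P) hsep
  let φ : P.SplittingField →ₐ[F] ℂ := Polynomial.SplittingField.lift P (IsAlgClosed.splits _)
  have hne : P ≠ 0 := minpoly.ne_zero hz
  have hz' : z ∈ P.rootSet ℂ := by
    rw [Polynomial.mem_rootSet]; exact ⟨hne, minpoly.aeval F z⟩
  rw [← hsp.image_rootSet φ] at hz'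
  obtain ⟨γ, -, hγ⟩ := hz'
  exact ⟨P.SplittingField, inferInstance, inferInstance, inferInstance, hG, φ.toRingHom, γ, hγ⟩

theorem transcendental_pi' : Transcendental ℚ Real.pi := by
  intro hpi
  have h1 : IsAlgebraic ℚ ((Real.pi : ℂ)) := by
    simpa using hpi.algebraMap (A := ℂ)
  have hI : IsAlgebraic ℚ Complex.I := by
    refine IsAlgebraic.of_pow (n := 2) (by norm_num) ?_
    rw [Complex.I_sq]
    exact (isAlgebraic_one).neg
  have h2 : IsAlgebraic ℚ ((Real.pi : ℂ) * Complex.I) := h1.mul hI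
  obtain ⟨L, _, _, _, _, φ, γ, hγ⟩ := exists_galois_aux (F := ℚ) _ h2.isIntegral
    (minpoly.irreducible h2.isIntegral).separable
  apply aux_exp_ne φ γ
  rw [hγ, Complex.exp_pi_mul_I]; ring

open Polynomial in
noncomputable def cotPoly : ℕ → ℤ[X]
  | 0 => X
  | k + 1 => (1 + X ^ 2) * derivative (cotPoly k)

open Polynomial in
theorem cotPoly_comp (k : ℕ) : (cotPoly k).comp (-X) = (-1) ^ (k + 1) * cotPoly k := by
  induction k with
  | zero => simp [cotPoly]
  | succ k ih =>
    have h := congrArg derivative ih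
    have hc : ((-1 : ℤ[X]) ^ (k + 1)) = C ((-1) ^ (k + 1)) := by simp
    rw [derivative_comp, hc, derivative_C_mul, ← hc] at h
    simp only [derivative_neg, derivative_X] at h
    simp only [cotPoly, mul_comp, add_comp, one_comp, pow_comp, X_comp]
    rw [pow_succ (-1 : ℤ[X]) (k + 1)]
    linear_combination (-(1 + X ^ 2)) * h

open Polynomial in
theorem cotPoly_coeff (k : ℕ) : (∀ i, 0 ≤ (cotPoly k).coeff i) ∧ 0 < (cotPoly k).coeff (k + 1) := by
  induction k with
  | zero =>
    refine ⟨fun i => ?_, by simp [cotPoly]⟩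
    simp only [cotPoly, coeff_X]; split_ifs <;> simp
  | succ k ih =>
    obtain ⟨h1, h2⟩ := ih
    have hd : ∀ i, 0 ≤ (derivative (cotPoly k)).coeff i := fun i => by
      rw [coeff_derivative]; exact mul_nonneg (h1 _) (by positivity)
    have hd2 : 0 < (derivative (cotPoly k)).coeff k := by
      rw [coeff_derivative]; exact mul_pos h2 (by positivity)
    constructor
    · intro i
      simp only [cotPoly, add_mul, one_mul, coeff_add, coeff_X_pow_mul']
      split_ifs
      · exact add_nonneg (hd _) (hd _)
      · simpa using hd i
    · simp only [cotPoly, add_mul, one_mul, coeff_add, coeff_X_pow_mul']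
      rw [if_pos (by omega)]
      exact add_pos_of_nonneg_of_pos (hd _) (by simpa using hd2)

open Polynomial in
theorem cotPoly_pos (k : ℕ) (x : ℝ) (hx : 0 < x) : 0 < aeval x (cotPoly k) := by
  obtain ⟨h1, h2⟩ := cotPoly_coeff k
  rw [aeval_eq_sum_range]
  refine Finset.sum_pos' (fun i _ => ?_) ⟨k + 1, ?_, ?_⟩
  · rw [zsmul_eq_mul]
    exact mul_nonneg (by exact_mod_cast h1 i) (by positivity)
  · rw [Finset.mem_range, Nat.lt_succ_iff]
    exact le_natDegree_of_ne_zero h2.ne'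
  · rw [zsmul_eq_mul]
    exact mul_pos (by exact_mod_cast h2) (by positivity)

open Polynomial in
theorem cotPoly_odd (k : ℕ) (hk : Even k) (x : ℝ) :
    aeval (-x) (cotPoly k) = - aeval x (cotPoly k) := by
  have h := congrArg (aeval x) (cotPoly_comp k)
  rw [aeval_comp] at h
  simpa [pow_succ, hk.neg_one_pow] using h

open Polynomial in
theorem iteratedDeriv_cot (k : ℕ) : ∀ x : ℝ, Real.sin (Real.pi * x) ≠ 0 →
    iteratedDeriv k (fun x : ℝ => Real.pi * (Real.cos (Real.pi * x) / Real.sin (Real.pi * x))) x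
      = (-1) ^ k * Real.pi ^ (k + 1) *
        aeval (Real.cos (Real.pi * x) / Real.sin (Real.pi * x)) (cotPoly k) := by
  induction k with
  | zero => intro x hx; simp [cotPoly]
  | succ k ih =>
    intro x hx
    have hopen : ∀ᶠ y in nhds x, Real.sin (Real.pi * y) ≠ 0 := by
      have : Continuous fun y : ℝ => Real.sin (Real.pi * y) := by fun_prop
      exact this.continuousAt.eventually_ne hx
    rw [iteratedDeriv_succ, Filter.EventuallyEq.deriv_eq (hopen.mono ih)]
    have hlin : HasDerivAt (fun y : ℝ => Real.pi * y) Real.pi x := by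
      simpa using (hasDerivAt_id x).const_mul Real.pi
    have hcot := hlin.cos.div hlin.sin hx
    have hp := (Polynomial.hasDerivAt_aeval (cotPoly k)
      (Real.cos (Real.pi * x) / Real.sin (Real.pi * x))).comp x hcot
    have := (hp.const_mul ((-1) ^ k * Real.pi ^ (k + 1))).deriv
    refine Eq.trans this ?_
    simp only [cotPoly, map_mul, map_add, map_one, map_pow, aeval_X]
    field_simp
    ring

theorem analyticAt_Gamma_real (x : ℝ) (hx : Real.sin (Real.pi * x) ≠ 0) :
    AnalyticAt ℝ Real.Gamma x := by
  have hne : ∀ y : ℝ, Real.sin (Real.pi * y) ≠ 0 → ∀ m : ℕ, y ≠ -m := by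
    rintro y hy m rfl
    apply hy
    have := Real.sin_int_mul_pi (-m)
    push_cast at this
    rw [mul_comm]; exact this
  have hA : AnalyticAt ℂ Complex.Gamma x := by
    rw [Complex.analyticAt_iff_eventually_differentiableAt]
    have : ∀ᶠ z in nhds (x : ℂ), Complex.sin (Real.pi * z) ≠ 0 := by
      have hc : Continuous fun y : ℂ => Complex.sin (Real.pi * y) := by fun_prop
      refine hc.continuousAt.eventually_ne ?_
      exact_mod_cast hx
    filter_upwards [this] with z hz
    refine Complex.differentiableAt_Gamma z ?_
    rintro m rfl
    apply hz
    have := Complex.sin_int_mul_pi (-m)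
    push_cast at this
    rw [mul_comm]; exact this
  have := (hA.contDiffAt (n := ⊤)).real_of_complex
  exact this.analyticAt

theorem Gamma_real_ne_zero (x : ℝ) (hx : Real.sin (Real.pi * x) ≠ 0) : Real.Gamma x ≠ 0 := by
  refine Real.Gamma_ne_zero ?_
  rintro m rfl
  apply hx
  have := Real.sin_int_mul_pi (-m)
  push_cast at this
  rw [mul_comm]; exact this

theorem analyticAt_digamma (x : ℝ) (hx : Real.sin (Real.pi * x) ≠ 0) :
    AnalyticAt ℝ digamma x :=
  (analyticAt_Gamma_real x hx).deriv.div (analyticAt_Gamma_real x hx) (Gamma_real_ne_zero x hx)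

theorem sin_one_sub (x : ℝ) : Real.sin (Real.pi * (1 - x)) = Real.sin (Real.pi * x) := by
  rw [mul_sub, mul_one, Real.sin_pi_sub]

theorem digamma_reflect (x : ℝ) (hx : Real.sin (Real.pi * x) ≠ 0) :
    digamma (1 - x) - digamma x
      = Real.pi * (Real.cos (Real.pi * x) / Real.sin (Real.pi * x)) := by
  have hx' : Real.sin (Real.pi * (1 - x)) ≠ 0 := by rwa [sin_one_sub]
  have h1 := (analyticAt_Gamma_real x hx).differentiableAt.hasDerivAt
  have h2 := (analyticAt_Gamma_real (1 - x) hx').differentiableAt.hasDerivAt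
  have h3 := h1.mul (h2.comp x ((hasDerivAt_id x).const_sub 1))
  have hlin : HasDerivAt (fun y : ℝ => Real.pi * y) Real.pi x := by
    simpa using (hasDerivAt_id x).const_mul Real.pi
  have h4 := (hasDerivAt_const x Real.pi).div hlin.sin hx
  have heq := Real.Gamma_mul_Gamma_one_sub x
  have h5 := h3.unique (h4.congr_of_eventuallyEq (Filter.Eventually.of_forall fun y =>
    Real.Gamma_mul_Gamma_one_sub y))
  have g1 := Gamma_real_ne_zero x hx
  have g2 := Gamma_real_ne_zero (1 - x) hx'
  simp only [Function.comp] at h5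
  unfold digamma
  rw [div_sub_div _ _ g2 g1, mul_comm (Real.Gamma (1 - x)) (Real.Gamma x), heq]
  have h6 : deriv Real.Gamma (1 - x) * Real.Gamma x - Real.Gamma (1 - x) * deriv Real.Gamma x
      = Real.pi * (Real.cos (Real.pi * x) * Real.pi) / Real.sin (Real.pi * x) ^ 2 := by
    linear_combination -h5
  rw [h6]
  have := Real.pi_ne_zero
  field_simp

theorem key_eq (k : ℕ) (hk : Even k) (x : ℝ) (hx : Real.sin (Real.pi * x) ≠ 0) :
    iteratedDeriv k digamma (1 - x) - iteratedDeriv k digamma x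
      = Real.pi ^ (k + 1) * Polynomial.aeval
        (Real.cos (Real.pi * x) / Real.sin (Real.pi * x)) (cotPoly k) := by
  have hx' : Real.sin (Real.pi * (1 - x)) ≠ 0 := by rwa [sin_one_sub]
  have hopen : ∀ᶠ y in nhds x, Real.sin (Real.pi * y) ≠ 0 := by
    have : Continuous fun y : ℝ => Real.sin (Real.pi * y) := by fun_prop
    exact this.continuousAt.eventually_ne hx
  have h1 := iteratedDeriv_cot k x hx
  have h2 : (fun y => digamma (1 - y) - digamma y) =ᶠ[nhds x]
    (fun x : ℝ => Real.pi * (Real.cos (Real.pi * x) / Real.sin (Real.pi * x))) :=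
    hopen.mono digamma_reflect
  rw [← h2.iteratedDeriv_eq k, hk.neg_one_pow, one_mul] at h1
  rw [← h1, iteratedDeriv_fun_sub, iteratedDeriv_comp_const_sub]
  · simp [hk.neg_one_pow]
  · exact ((analyticAt_digamma (1 - x) hx').contDiffAt).comp x (by fun_prop)
  · exact (analyticAt_digamma x hx).contDiffAt


theorem stmt_14 (k : ℕ) (hk : 0 < k) (hke : Even k) (α : ℚ) (hα : ¬ ∃ m : ℤ, α = m) :
    ((∃ m : ℤ, α = m + 1/2) →
        iteratedDeriv k digamma (1 - (α:ℝ)) - iteratedDeriv k digamma (α:ℝ) = 0) ∧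
    (¬ (∃ m : ℤ, α = m + 1/2) →
        Transcendental ℚ
          (iteratedDeriv k digamma (1 - (α:ℝ)) - iteratedDeriv k digamma (α:ℝ))) := by
  have hs : Real.sin (Real.pi * (α : ℝ)) ≠ 0 := by
    intro h
    obtain ⟨m, hm⟩ := Real.sin_eq_zero_iff.1 h
    refine hα ⟨m, ?_⟩
    rw [mul_comm] at hm
    have := mul_left_cancel₀ Real.pi_ne_zero hm
    exact_mod_cast this.symm
  rw [key_eq k hke α hs]
  constructor
  · rintro ⟨m, hm⟩
    have hc : Real.cos (Real.pi * (α : ℝ)) = 0 := by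
      rw [Real.cos_eq_zero_iff]
      refine ⟨m, ?_⟩
      rw [hm]; push_cast; ring
    rw [hc, zero_div]
    have := cotPoly_odd k hke 0
    rw [neg_zero] at this
    rw [show Polynomial.aeval (0 : ℝ) (cotPoly k) = 0 by linarith, mul_zero]
  · intro hm halg
    have hc : Real.cos (Real.pi * (α : ℝ)) ≠ 0 := by
      intro h
      obtain ⟨m, hm'⟩ := Real.cos_eq_zero_iff.1 h
      refine hm ⟨m, ?_⟩
      have h1 : Real.pi * (α : ℝ) = Real.pi * (m + 1 / 2) := by rw [hm']; ring
      have h2 := mul_left_cancel₀ Real.pi_ne_zero h1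
      have h3 : ((α : ℚ) : ℝ) = ((m + 1 / 2 : ℚ) : ℝ) := by rw [h2]; push_cast; ring
      exact_mod_cast h3
    set t := Real.cos (Real.pi * (α : ℝ)) / Real.sin (Real.pi * (α : ℝ)) with ht
    have htne : t ≠ 0 := div_ne_zero hc hs
    have hA : Polynomial.aeval t (cotPoly k) ≠ 0 := by
      rcases lt_or_gt_of_ne htne with h | h
      · have h1 := cotPoly_pos k (-t) (by linarith)
        rw [cotPoly_odd k hke] at h1
        intro h2; linarith
      · exact (cotPoly_pos k t h).ne'
    have hta : IsAlgebraic ℚ t := by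
      have h1 := (Real.isAlgebraic_cos_rat_mul_pi α).extendScalars (S := ℚ) Int.cast_injective
      have h2 := (Real.isAlgebraic_sin_rat_mul_pi α).extendScalars (S := ℚ) Int.cast_injective
      rw [mul_comm] at h1 h2
      rw [ht, div_eq_mul_inv]
      exact h1.mul h2.inv
    have hAalg : IsAlgebraic ℚ (Polynomial.aeval t (cotPoly k)) := by
      have h := hta.isIntegral
      rw [Polynomial.aeval_eq_sum_range]
      refine (IsIntegral.sum _ fun i _ => ?_).isAlgebraic
      rw [zsmul_eq_mul]
      refine IsIntegral.mul ?_ (h.pow i)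
      simpa using (isIntegral_algebraMap (R := ℚ) (A := ℝ) (x := ((cotPoly k).coeff i : ℚ)))
    have hpk : IsAlgebraic ℚ (Real.pi ^ (k + 1)) := by
      have := halg.mul hAalg.inv
      rwa [mul_assoc, mul_inv_cancel₀ hA, mul_one] at this
    exact transcendental_pi' (hpk.of_pow (Nat.succ_pos k))
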